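/- Let $1<p\leqslant q<+\infty$. There is a constant $C=C(p,q,d)$ such that for every sequence $f=(f_n)_{n\in\mathbb{N}}$ of measurable functions on $\mathbb{R}^d$ with $x\mapsto\left(\sum_{n=0}^{\infty}|f_n(x)|^q\right)^{1/q}$ in $L^p(\mathbb{R}^d)$, one has $\left\|\left(\sum_{n=0}^{\infty}(M_Hf_n)^q\right)^{1/q}\right\|_{L^p(\mathbb{R}^d)}\leqslant C\left\|\left(\sum_{n=0}^{\infty}|f_n|^q\right)^{1/q}\right\|_{L^p(\mathbb{R}^d)}$, where $M_H$ is the Euclidean heat maximal operator. -/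

import Mathlib

open MeasureTheory ENNReal

/-- The Hardy-Littlewood maximal operator on `ℝ^d`:
`M f (x) = sup_{r > 0} (1/|B_r(x)|) ∫_{B_r(x)} |f(y)| dy`. -/
noncomputable def hlMax {d : ℕ} (f : EuclideanSpace ℝ (Fin d) → ℝ)
    (x : EuclideanSpace ℝ (Fin d)) : ℝ≥0∞ :=
  ⨆ (r : ℝ) (_ : 0 < r),
    (volume (Metric.ball x r))⁻¹ * ∫⁻ y in Metric.ball x r, ‖f y‖₊ ∂volume

/-- The Euclidean heat semi-group applied to `|f|`:
`H_t |f| (x) = ∫ (4πt)^{-d/2} e^{-‖x-y‖²/(4t)} |f(y)| dy`. -/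
noncomputable def heatAbs {d : ℕ} (f : EuclideanSpace ℝ (Fin d) → ℝ) (t : ℝ)
    (x : EuclideanSpace ℝ (Fin d)) : ℝ≥0∞ :=
  ∫⁻ y, ENNReal.ofReal ((4 * Real.pi * t) ^ (-(d : ℝ) / 2) *
    Real.exp (-‖x - y‖ ^ 2 / (4 * t))) * ‖f y‖₊ ∂volume

/-- The Euclidean heat maximal operator
`M_H f (x) = sup_{α > 0} (1/α) ∫_0^α H_t |f| (x) dt`. -/
noncomputable def heatMax {d : ℕ} (f : EuclideanSpace ℝ (Fin d) → ℝ)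
    (x : EuclideanSpace ℝ (Fin d)) : ℝ≥0∞ :=
  ⨆ (α : ℝ) (_ : 0 < α),
    (ENNReal.ofReal α)⁻¹ * ∫⁻ t in Set.Ioc (0 : ℝ) α, heatAbs f t x

open Metric Set

section DyadicMaximal

variable {X : Type*} [MetricSpace X] [MeasurableSpace X]

/-- The centred maximal function of `g` with respect to `μ`, over closed balls whose radius is an
integer power of two. -/
noncomputable def dyadicMax (μ : Measure X) (g : X → ℝ≥0∞) (x : X) : ℝ≥0∞ :=
  ⨆ k : ℤ, (μ (closedBall x (2 ^ k)))⁻¹ * ∫⁻ y in closedBall x (2 ^ k), g y ∂μ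

/-- Balls of dyadic radius have positive finite measure, and enlarging such a ball five times
multiplies its measure by at most `D`. -/
structure DyadicDoubling (μ : Measure X) (D : ℝ≥0∞) : Prop where
  ne_zero : ∀ x (k : ℤ), μ (closedBall x (2 ^ k)) ≠ 0
  ne_top : ∀ x (k : ℤ), μ (closedBall x (2 ^ k)) ≠ ∞
  le_mul : ∀ x (k : ℤ), μ (closedBall x (5 * 2 ^ k)) ≤ D * μ (closedBall x (2 ^ k))

lemma lintegral_closedBall_le_dyadicMax {μ : Measure X} {D : ℝ≥0∞} (hμ : DyadicDoubling μ D)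
    (g : X → ℝ≥0∞) (x : X) (k : ℤ) :
    ∫⁻ y in closedBall x (2 ^ k), g y ∂μ ≤ dyadicMax μ g x * μ (closedBall x (2 ^ k)) := by
  rw [← ENNReal.div_le_iff_le_mul (Or.inl (hμ.ne_zero x k)) (Or.inl (hμ.ne_top x k)),
    ENNReal.div_eq_inv_mul]
  exact le_iSup (fun k : ℤ => (μ (closedBall x (2 ^ k)))⁻¹ *
    ∫⁻ y in closedBall x (2 ^ k), g y ∂μ) k

lemma dyadicMax_mono {μ : Measure X} {f g : X → ℝ≥0∞} (h : ∀ x, f x ≤ g x) (x : X) :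
    dyadicMax μ f x ≤ dyadicMax μ g x :=
  iSup_mono fun _ => mul_le_mul_right (lintegral_mono h) _

lemma dyadicMax_add_const_le {μ : Measure X} {D : ℝ≥0∞} (hμ : DyadicDoubling μ D)
    (g : X → ℝ≥0∞) (c : ℝ≥0∞) (x : X) :
    dyadicMax μ (fun y => g y + c) x ≤ dyadicMax μ g x + c := by
  refine iSup_le fun k => ?_
  rw [lintegral_add_right _ measurable_const, mul_add, setLIntegral_const, mul_comm c, ← mul_assoc,
    ENNReal.inv_mul_cancel (hμ.ne_zero x k) (hμ.ne_top x k), one_mul]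
  gcongr
  exact le_iSup (fun k : ℤ => (μ (closedBall x (2 ^ k)))⁻¹ *
    ∫⁻ y in closedBall x (2 ^ k), g y ∂μ) k

lemma dyadicMax_tsum_le {μ : Measure X} (g : ℕ → X → ℝ≥0∞)
    (hg : ∀ n, Measurable (g n)) (c : ℕ → ℝ≥0∞) (x : X) :
    dyadicMax μ (fun y => ∑' n, c n * g n y) x ≤ ∑' n, c n * dyadicMax μ (g n) x := by
  refine iSup_le fun k => ?_
  rw [lintegral_tsum fun n => ((hg n).const_mul _).aemeasurable, ← ENNReal.tsum_mul_left]
  refine ENNReal.tsum_le_tsum fun n => ?_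
  rw [lintegral_const_mul _ (hg n), mul_left_comm]
  exact mul_le_mul_right (le_iSup (fun k : ℤ => (μ (closedBall x (2 ^ k)))⁻¹ *
    ∫⁻ y in closedBall x (2 ^ k), g n y ∂μ) k) _

variable [SecondCountableTopology X] [BorelSpace X]

lemma measurable_setLIntegral_closedBall {μ : Measure X} [SFinite μ] {g : X → ℝ≥0∞}
    (hg : Measurable g) (r : ℝ) : Measurable fun x => ∫⁻ y in closedBall x r, g y ∂μ := by
  have h : ∀ x, ∫⁻ y in closedBall x r, g y ∂μ =
      ∫⁻ y, ({z : X × X | dist z.2 z.1 ≤ r}.indicator fun z => g z.2) (x, y) ∂μ := by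
    intro x
    rw [← lintegral_indicator measurableSet_closedBall]
    rfl
  simp_rw [h]
  refine Measurable.lintegral_prod_right' ?_
  refine (hg.comp measurable_snd).indicator ?_
  exact measurableSet_le (measurable_snd.dist measurable_fst) measurable_const

lemma measurable_dyadicMax {μ : Measure X} [SFinite μ] {g : X → ℝ≥0∞} (hg : Measurable g) :
    Measurable (dyadicMax μ g) := by
  refine Measurable.iSup fun k => Measurable.mul ?_ (measurable_setLIntegral_closedBall hg _)
  have := measurable_setLIntegral_closedBall (μ := μ) (g := fun _ => 1) measurable_const (2 ^ k)
  simp only [setLIntegral_one] at this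
  exact this.inv

/-- Weak type `(1, 1)` estimate for the dyadic-radius maximal function. -/
lemma mul_meas_lt_dyadicMax_le {μ : Measure X} {D : ℝ≥0∞} (hμ : DyadicDoubling μ D)
    (g : X → ℝ≥0∞) (l : ℝ≥0∞) :
    l * μ {x | l < dyadicMax μ g x} ≤ D * ∫⁻ x, g x ∂μ := by
  let E : ℕ → Set X := fun N => {x | ∃ k : ℤ, k ≤ N ∧
    l * μ (closedBall x (2 ^ k)) ≤ ∫⁻ y in closedBall x (2 ^ k), g y ∂μ}
  have hE : ∀ N, l * μ (E N) ≤ D * ∫⁻ x, g x ∂μ := by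
    intro N
    choose! k hkN hk using fun (x : X) (hx : x ∈ E N) => hx
    obtain ⟨u, huE, hdisj, hcov⟩ :=
      Vitali.exists_disjoint_subfamily_covering_enlargement_closedBall (E N) (fun x => x)
        (fun x => (2 : ℝ) ^ (k x)) (2 ^ (N : ℤ))
        (fun x hx => zpow_le_zpow_right₀ one_le_two (hkN x hx)) 5 (by norm_num)
    have hcount : u.Countable := hdisj.countable_of_nonempty_interior fun x _ =>
      ⟨x, ball_subset_interior_closedBall (mem_ball_self (by positivity))⟩
    calc l * μ (E N) ≤ l * μ (⋃ x ∈ u, closedBall x (5 * 2 ^ (k x))) := by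
          gcongr
          intro x hx
          obtain ⟨b, hb, hsub⟩ := hcov x hx
          exact mem_iUnion₂.2 ⟨b, hb, hsub (mem_closedBall_self (by positivity))⟩
      _ ≤ l * ∑' x : u, μ (closedBall (x : X) (5 * 2 ^ (k x))) := by
          gcongr
          exact measure_biUnion_le μ hcount _
      _ ≤ l * ∑' x : u, D * μ (closedBall (x : X) (2 ^ (k x))) := by
          gcongr with x
          exact hμ.le_mul _ _
      _ = D * ∑' x : u, l * μ (closedBall (x : X) (2 ^ (k x))) := by
          rw [ENNReal.tsum_mul_left, ENNReal.tsum_mul_left]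
          ring
      _ ≤ D * ∑' x : u, ∫⁻ y in closedBall (x : X) (2 ^ (k x)), g y ∂μ := by
          gcongr with x
          exact hk x (huE x.2)
      _ = D * ∫⁻ y in ⋃ x ∈ u, closedBall x (2 ^ (k x)), g y ∂μ := by
          rw [lintegral_biUnion hcount (fun _ _ => measurableSet_closedBall) hdisj]
      _ ≤ D * ∫⁻ x, g x ∂μ := by
          gcongr
          exact Measure.restrict_le_self
  have hmono : Monotone E := by
    rintro N N' hN x ⟨k, hk, hx⟩
    exact ⟨k, hk.trans (by exact_mod_cast hN), hx⟩
  calc l * μ {x | l < dyadicMax μ g x} ≤ l * μ (⋃ N, E N) := by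
        gcongr
        intro x hx
        obtain ⟨k, hk⟩ := lt_iSup_iff.1 (show l < dyadicMax μ g x from hx)
        refine mem_iUnion.2 ⟨k.toNat, k, Int.self_le_toNat k, ?_⟩
        rw [← ENNReal.div_eq_inv_mul] at hk
        exact (ENNReal.mul_lt_of_lt_div hk).le
    _ = ⨆ N, l * μ (E N) := by rw [hmono.measure_iUnion, ENNReal.mul_iSup]
    _ ≤ D * ∫⁻ x, g x ∂μ := iSup_le hE

lemma mul_meas_lt_dyadicMax_le_setLIntegral {μ : Measure X} {D : ℝ≥0∞} (hμ : DyadicDoubling μ D)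
    {g : X → ℝ≥0∞} (hg : Measurable g) {l : ℝ≥0∞} (hl : l ≠ ∞) :
    l * μ {x | l < dyadicMax μ g x} ≤ 2 * D * ∫⁻ x in {x | l < 2 * g x}, g x ∂μ := by
  have hs : MeasurableSet {x | l < 2 * g x} := measurableSet_lt measurable_const (hg.const_mul 2)
  have hl2 : l / 2 ≠ ∞ := ENNReal.div_ne_top hl two_ne_zero
  have hsub : {x | l < dyadicMax μ g x} ⊆
      {x | l / 2 < dyadicMax μ ({x | l < 2 * g x}.indicator g) x} := by
    intro x hx
    have h1 : dyadicMax μ g x ≤ dyadicMax μ ({x | l < 2 * g x}.indicator g) x + l / 2 := by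
      refine (dyadicMax_mono (fun y => ?_) x).trans (dyadicMax_add_const_le hμ _ _ x)
      by_cases hy : l < 2 * g y
      · rw [indicator_of_mem (show y ∈ {x | l < 2 * g x} from hy)]
        exact le_self_add
      · rw [indicator_of_notMem (show y ∉ {x | l < 2 * g x} from hy), zero_add,
          ENNReal.le_div_iff_mul_le (by simp) (by simp), mul_comm]
        exact not_lt.1 hy
    have h2 : l / 2 + l / 2 < dyadicMax μ ({x | l < 2 * g x}.indicator g) x + l / 2 := by
      rw [ENNReal.add_halves]
      exact lt_of_lt_of_le hx h1
    exact (ENNReal.add_lt_add_iff_right hl2).1 h2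
  calc l * μ {x | l < dyadicMax μ g x}
      ≤ 2 * (l / 2 * μ {x | l / 2 < dyadicMax μ ({x | l < 2 * g x}.indicator g) x}) := by
        rw [← mul_assoc, ENNReal.mul_div_cancel two_ne_zero ofNat_ne_top]
        gcongr
    _ ≤ 2 * (D * ∫⁻ x, {x | l < 2 * g x}.indicator g x ∂μ) :=
        mul_le_mul_right (mul_meas_lt_dyadicMax_le hμ _ _) _
    _ = 2 * D * ∫⁻ x in {x | l < 2 * g x}, g x ∂μ := by
        rw [lintegral_indicator hs, mul_assoc]

/-- The layer-cake formula for powers of a single extended nonnegative number. -/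
lemma lintegral_rpow_indicator_lt (a : ℝ≥0∞) {s : ℝ} (hs : 0 < s) :
    ∫⁻ t in Ioi (0 : ℝ), ENNReal.ofReal (t ^ (s - 1)) *
      {t : ℝ | ENNReal.ofReal t < a}.indicator 1 t = ENNReal.ofReal s⁻¹ * a ^ s := by
  have hfin : ∀ b : ℝ, 0 ≤ b → ∫⁻ t in Ioi (0 : ℝ), ENNReal.ofReal (t ^ (s - 1)) *
      {t : ℝ | ENNReal.ofReal t < ENNReal.ofReal b}.indicator 1 t =
        ENNReal.ofReal s⁻¹ * ENNReal.ofReal b ^ s := by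
    intro b hb
    have h1 : ∫⁻ t in Ioi (0 : ℝ), ENNReal.ofReal (t ^ (s - 1)) *
        {t : ℝ | ENNReal.ofReal t < ENNReal.ofReal b}.indicator 1 t =
        ∫⁻ t in Ioo (0 : ℝ) b, ENNReal.ofReal (t ^ (s - 1)) := by
      rw [← lintegral_indicator measurableSet_Ioi, ← lintegral_indicator measurableSet_Ioo]
      congr 1 with t
      by_cases ht : 0 < t
      · by_cases htb : t < b
        · simp [indicator, ht, htb, ENNReal.ofReal_lt_ofReal_iff (ht.trans htb)]
        · simp [indicator, ht, htb, ENNReal.ofReal_le_ofReal (not_lt.1 htb)]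
      · simp [indicator, ht]
    have hint : IntervalIntegrable (fun t : ℝ => t ^ (s - 1)) volume 0 b :=
      intervalIntegral.intervalIntegrable_rpow' (by linarith)
    rw [h1, Measure.restrict_congr_set Ioo_ae_eq_Ioc, ← ofReal_integral_eq_lintegral_ofReal,
      ← intervalIntegral.integral_of_le hb, integral_rpow (Or.inl (by linarith)),
      sub_add_cancel, Real.zero_rpow hs.ne', sub_zero, ENNReal.ofReal_rpow_of_nonneg hb hs.le,
      ← ENNReal.ofReal_mul (by positivity), div_eq_inv_mul]
    · exact (intervalIntegrable_iff_integrableOn_Ioc_of_le hb).1 hint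
    · exact (ae_restrict_mem measurableSet_Ioc).mono fun t ht => Real.rpow_nonneg ht.1.le _
  by_cases ha : a = ∞
  · subst ha
    rw [ENNReal.top_rpow_of_pos hs, ENNReal.mul_top (by simpa using hs)]
    refine ENNReal.eq_top_of_forall_nnreal_le fun r => ?_
    refine le_trans ?_ (le_trans (hfin ((s * r) ^ s⁻¹) (by positivity)).ge ?_)
    · rw [ENNReal.ofReal_rpow_of_nonneg (by positivity) hs.le, ← ENNReal.ofReal_mul (by positivity),
        ← Real.rpow_mul (by positivity), inv_mul_cancel₀ hs.ne', Real.rpow_one,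
        inv_mul_cancel_left₀ hs.ne']
      simp
    · refine lintegral_mono fun t => mul_le_mul_right ?_ _
      exact indicator_le_indicator_of_subset (fun t _ => ENNReal.ofReal_lt_top) (fun _ => zero_le) t
  · have := hfin a.toReal ENNReal.toReal_nonneg
    rwa [ENNReal.ofReal_toReal ha] at this

/-- The constant in the strong type `(q, q)` bound for the dyadic-radius maximal function. -/
noncomputable def dyadicMaxConst (D : ℝ≥0∞) (q : ℝ) : ℝ≥0∞ :=
  ENNReal.ofReal q * (2 * D * (ENNReal.ofReal (q - 1)⁻¹ * 2 ^ (q - 1)))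

lemma dyadicMaxConst_ne_top {D : ℝ≥0∞} (hD : D ≠ ∞) {q : ℝ} (hq : 1 < q) :
    dyadicMaxConst D q ≠ ∞ := by
  have h2 : (2 : ℝ≥0∞) ^ (q - 1) ≠ ∞ := ENNReal.rpow_ne_top_of_nonneg (by linarith) (by simp)
  unfold dyadicMaxConst
  finiteness

/-- Strong type `(q, q)` estimate for the dyadic-radius maximal function, `1 < q < ∞`. -/
lemma lintegral_dyadicMax_rpow_le {μ : Measure X} [SFinite μ] {D : ℝ≥0∞}
    (hμ : DyadicDoubling μ D) {g : X → ℝ≥0∞} (hg : Measurable g) {q : ℝ} (hq : 1 < q) :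
    ∫⁻ x, dyadicMax μ g x ^ q ∂μ ≤ dyadicMaxConst D q * ∫⁻ x, g x ^ q ∂μ := by
  have hq0 : 0 < q := by linarith
  have hq1 : 0 < q - 1 := by linarith
  have hM := measurable_dyadicMax (μ := μ) hg
  have key : ∀ (G : X → ℝ≥0∞) (s : ℝ), Measurable G →
      Measurable (Function.uncurry fun (x : X) (t : ℝ) => ENNReal.ofReal (t ^ (s - 1)) *
        {t : ℝ | ENNReal.ofReal t < G x}.indicator 1 t) := by
    intro G s hG
    refine Measurable.mul (by fun_prop) ?_
    exact (measurable_one (α := ℝ≥0∞) (β := X × ℝ)).indicator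
      (s := {z : X × ℝ | ENNReal.ofReal z.2 < G z.1})
      (measurableSet_lt (by fun_prop) (by fun_prop))
  have hlevel : ∀ t : ℝ, 0 < t → ∫⁻ x, ENNReal.ofReal (t ^ (q - 1)) *
      {t : ℝ | ENNReal.ofReal t < dyadicMax μ g x}.indicator 1 t ∂μ ≤
      2 * D * ∫⁻ x, ENNReal.ofReal (t ^ (q - 1 - 1)) *
        {t : ℝ | ENNReal.ofReal t < 2 * g x}.indicator 1 t * g x ∂μ := by
    intro t ht
    have e1 : ∀ G : X → ℝ≥0∞, (fun x => {t : ℝ | ENNReal.ofReal t < G x}.indicator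
        (1 : ℝ → ℝ≥0∞) t) = {x | ENNReal.ofReal t < G x}.indicator 1 := fun G => rfl
    have hpow : t ^ (q - 1) = t ^ (q - 1 - 1) * t := by
      rw [← Real.rpow_add_one ht.ne', sub_add_cancel]
    calc ∫⁻ x, ENNReal.ofReal (t ^ (q - 1)) *
          {t : ℝ | ENNReal.ofReal t < dyadicMax μ g x}.indicator 1 t ∂μ
        = ENNReal.ofReal (t ^ (q - 1 - 1)) *
          (ENNReal.ofReal t * μ {x | ENNReal.ofReal t < dyadicMax μ g x}) := by
          rw [lintegral_const_mul' _ _ (by finiteness), e1, lintegral_indicator_one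
            (measurableSet_lt measurable_const hM), hpow, ENNReal.ofReal_mul (by positivity),
            mul_assoc]
      _ ≤ ENNReal.ofReal (t ^ (q - 1 - 1)) *
          (2 * D * ∫⁻ x in {x | ENNReal.ofReal t < 2 * g x}, g x ∂μ) := by
          exact mul_le_mul_right (mul_meas_lt_dyadicMax_le_setLIntegral hμ hg (by finiteness)) _
      _ = 2 * D * ∫⁻ x, ENNReal.ofReal (t ^ (q - 1 - 1)) *
        {t : ℝ | ENNReal.ofReal t < 2 * g x}.indicator 1 t * g x ∂μ := by
          simp_rw [mul_assoc (ENNReal.ofReal (t ^ (q - 1 - 1)))]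
          rw [lintegral_const_mul' _ _ (by finiteness), ← lintegral_indicator
            (measurableSet_lt measurable_const (hg.const_mul 2)), mul_left_comm]
          congr 2
          refine lintegral_congr fun x => ?_
          by_cases hx : ENNReal.ofReal t < 2 * g x <;> simp [indicator, hx]
  calc ∫⁻ x, dyadicMax μ g x ^ q ∂μ
      = ENNReal.ofReal q * ∫⁻ x, (ENNReal.ofReal q⁻¹ * dyadicMax μ g x ^ q) ∂μ := by
        rw [lintegral_const_mul' _ _ (by finiteness), ← mul_assoc, ← ENNReal.ofReal_mul hq0.le,
          mul_inv_cancel₀ hq0.ne', ENNReal.ofReal_one, one_mul]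
    _ = ENNReal.ofReal q * ∫⁻ t in Ioi (0 : ℝ), ∫⁻ x, ENNReal.ofReal (t ^ (q - 1)) *
          {t : ℝ | ENNReal.ofReal t < dyadicMax μ g x}.indicator 1 t ∂μ := by
        simp_rw [← lintegral_rpow_indicator_lt _ hq0]
        rw [lintegral_lintegral_swap (key _ q hM).aemeasurable]
    _ ≤ ENNReal.ofReal q * ∫⁻ t in Ioi (0 : ℝ), 2 * D * ∫⁻ x, ENNReal.ofReal (t ^ (q - 1 - 1)) *
        {t : ℝ | ENNReal.ofReal t < 2 * g x}.indicator 1 t * g x ∂μ := by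
        gcongr 1
        exact setLIntegral_mono' measurableSet_Ioi hlevel
    _ = ENNReal.ofReal q * (2 * D * ∫⁻ x, (∫⁻ t in Ioi (0 : ℝ), ENNReal.ofReal (t ^ (q - 1 - 1)) *
        {t : ℝ | ENNReal.ofReal t < 2 * g x}.indicator 1 t) * g x ∂μ) := by
        have hm : Measurable (Function.uncurry fun (x : X) (t : ℝ) =>
            ENNReal.ofReal (t ^ (q - 1 - 1)) *
              {t : ℝ | ENNReal.ofReal t < 2 * g x}.indicator 1 t * g x) :=
          (key (fun x => 2 * g x) (q - 1) (hg.const_mul 2)).mul (hg.comp measurable_fst)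
        have hm' : Measurable fun t : ℝ => ∫⁻ x, ENNReal.ofReal (t ^ (q - 1 - 1)) *
            {t : ℝ | ENNReal.ofReal t < 2 * g x}.indicator 1 t * g x ∂μ :=
          Measurable.lintegral_prod_right' (hm.comp measurable_swap)
        rw [lintegral_const_mul _ hm', ← lintegral_lintegral_swap hm.aemeasurable]
        congr 3 with x
        exact lintegral_mul_const _ ((key (fun x => 2 * g x) (q - 1) (hg.const_mul 2)).comp
          measurable_prodMk_left)
    _ = ENNReal.ofReal q * (2 * D * ∫⁻ x, (ENNReal.ofReal (q - 1)⁻¹ * 2 ^ (q - 1)) *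
          g x ^ q ∂μ) := by
        congr 3 with x
        rw [lintegral_rpow_indicator_lt _ hq1, ENNReal.mul_rpow_of_nonneg _ _ hq1.le]
        have : g x ^ q = g x ^ (q - 1) * g x := by
          conv_rhs => rw [← ENNReal.rpow_one (g x), ← ENNReal.rpow_mul, one_mul,
            ← ENNReal.rpow_add_of_nonneg _ _ hq1.le zero_le_one, sub_add_cancel]
        rw [this]
        ring
    _ = dyadicMaxConst D q * ∫⁻ x, g x ^ q ∂μ := by
        rw [lintegral_const_mul _ (hg.pow_const q), dyadicMaxConst]
        ring

end DyadicMaximal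

section HaarMaximal

variable {E : Type*} [NormedAddCommGroup E] [NormedSpace ℝ E] [FiniteDimensional ℝ E]
  [MeasurableSpace E] [BorelSpace E] {ν : Measure E} [ν.IsAddHaarMeasure]

lemma addHaar_closedBall_mul_radius (x y : E) {c r : ℝ} (hc : 0 ≤ c) (hr : 0 ≤ r) :
    ν (closedBall x (c * r)) =
      ENNReal.ofReal (c ^ Module.finrank ℝ E) * ν (closedBall y r) := by
  rw [Measure.addHaar_closedBall _ _ (mul_nonneg hc hr), Measure.addHaar_closedBall _ _ hr,
    mul_pow, ENNReal.ofReal_mul (by positivity), mul_assoc]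

lemma dyadicDoubling_addHaar :
    DyadicDoubling ν (ENNReal.ofReal (5 ^ Module.finrank ℝ E)) where
  ne_zero x k := (measure_closedBall_pos ν x (by positivity)).ne'
  ne_top x k := measure_closedBall_lt_top.ne
  le_mul x k := (addHaar_closedBall_mul_radius x x (by norm_num) (by positivity)).le

/-- The measure whose density is an `A₁` weight is doubling. -/
lemma dyadicDoubling_withDensity {u : E → ℝ≥0∞} (hu : Measurable u) (hu0 : ∀ x, u x ≠ 0)
    (hutop : ∀ᵐ x ∂ν, u x ≠ ∞) {K : ℝ≥0∞} (hK : K ≠ ∞) (hA : ∀ x, dyadicMax ν u x ≤ K * u x) :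
    DyadicDoubling (ν.withDensity u) (K * ENNReal.ofReal (8 ^ Module.finrank ℝ E)) where
  ne_zero x k := by
    rw [withDensity_apply _ measurableSet_closedBall]
    refine (setLIntegral_pos_iff hu).2 ?_ |>.ne'
    rw [Function.support_eq_univ hu0, univ_inter]
    exact measure_closedBall_pos ν x (by positivity)
  ne_top x k := by
    rw [withDensity_apply _ measurableSet_closedBall]
    obtain ⟨y, hy, hyt⟩ : ∃ y ∈ closedBall x (2 ^ k), u y ≠ ∞ := by
      by_contra! h
      refine (measure_closedBall_pos ν x (show (0 : ℝ) < 2 ^ k by positivity)).ne' ?_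
      exact measure_mono_null (fun y hy => by simpa using h y hy) hutop
    refine ne_top_of_le_ne_top (b := K * u y * ν (closedBall y (2 ^ (k + 1)))) ?_ ?_
    · have := (measure_closedBall_lt_top (μ := ν) (x := y) (r := 2 ^ (k + 1))).ne
      finiteness
    · calc ∫⁻ z in closedBall x (2 ^ k), u z ∂ν ≤ ∫⁻ z in closedBall y (2 ^ (k + 1)), u z ∂ν := by
            refine lintegral_mono_set (closedBall_subset_closedBall' ?_)
            rw [zpow_add₀ two_ne_zero, zpow_one]
            linarith [mem_closedBall'.1 hy]
        _ ≤ dyadicMax ν u y * ν (closedBall y (2 ^ (k + 1))) :=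
            lintegral_closedBall_le_dyadicMax dyadicDoubling_addHaar u y _
        _ ≤ K * u y * ν (closedBall y (2 ^ (k + 1))) := mul_le_mul_left (hA y) _
  le_mul x k := by
    rw [withDensity_apply _ measurableSet_closedBall, withDensity_apply _ measurableSet_closedBall]
    have h0 := (measure_closedBall_pos ν x (show (0 : ℝ) < 2 ^ k by positivity)).ne'
    have ht := (measure_closedBall_lt_top (μ := ν) (x := x) (r := 2 ^ k)).ne
    set I := ∫⁻ z in closedBall x (5 * 2 ^ k), u z ∂ν
    set V := ν (closedBall x (2 ^ k))
    have hpt : ∀ y ∈ closedBall x (2 ^ k),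
        I ≤ K * ENNReal.ofReal (8 ^ Module.finrank ℝ E) * V * u y := by
      intro y hy
      have e : (2 : ℝ) ^ (k + 3) = 8 * 2 ^ k := by
        rw [zpow_add₀ two_ne_zero]
        norm_num
        ring
      calc I ≤ ∫⁻ z in closedBall y (2 ^ (k + 3)), u z ∂ν := by
            refine lintegral_mono_set (closedBall_subset_closedBall' ?_)
            have : (0 : ℝ) < 2 ^ k := by positivity
            rw [e]
            linarith [mem_closedBall'.1 hy]
        _ ≤ dyadicMax ν u y * ν (closedBall y (2 ^ (k + 3))) :=
            lintegral_closedBall_le_dyadicMax dyadicDoubling_addHaar u y _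
        _ ≤ (K * u y) * (ENNReal.ofReal (8 ^ Module.finrank ℝ E) * V) := by
            rw [e, addHaar_closedBall_mul_radius y x (by norm_num) (by positivity)]
            exact mul_le_mul_left (hA y) _
        _ = _ := by ring
    have hint : I * V ≤
        K * ENNReal.ofReal (8 ^ Module.finrank ℝ E) * (∫⁻ y in closedBall x (2 ^ k), u y ∂ν) * V := by
      calc I * V = ∫⁻ _ in closedBall x (2 ^ k), I ∂ν := by rw [setLIntegral_const]
        _ ≤ ∫⁻ y in closedBall x (2 ^ k),
            K * ENNReal.ofReal (8 ^ Module.finrank ℝ E) * V * u y ∂ν :=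
            setLIntegral_mono' measurableSet_closedBall hpt
        _ = _ := by
            rw [lintegral_const_mul _ hu]
            ring
    exact (ENNReal.mul_le_mul_iff_left h0 ht).1 hint

/-- Weighted bound for the maximal function: if `u` is an `A₁` weight, then the maximal function is
bounded on `L^q` with weight `u ^ (1 - q)`. -/
lemma lintegral_dyadicMax_rpow_mul_le {u : E → ℝ≥0∞} (hu : Measurable u) (hu0 : ∀ x, u x ≠ 0)
    (hutop : ∀ᵐ x ∂ν, u x ≠ ∞) {K : ℝ≥0∞} (hK : K ≠ ∞) (hA : ∀ x, dyadicMax ν u x ≤ K * u x)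
    {f : E → ℝ≥0∞} (hf : Measurable f) {q : ℝ} (hq : 1 < q) :
    ∫⁻ x, dyadicMax ν f x ^ q * u x ^ (1 - q) ∂ν ≤
      K ^ q * dyadicMaxConst (K * ENNReal.ofReal (8 ^ Module.finrank ℝ E)) q *
        ∫⁻ x, f x ^ q * u x ^ (1 - q) ∂ν := by
  have hq0 : 0 < q := by linarith
  set D := K * ENNReal.ofReal (8 ^ Module.finrank ℝ E)
  have hD : DyadicDoubling (ν.withDensity u) D := dyadicDoubling_withDensity hu hu0 hutop hK hA
  have hg : Measurable fun x => f x / u x := hf.div hu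
  have hpow : ∀ (a v : ℝ≥0∞), v ≠ 0 → v ≠ ∞ → (v * a) ^ q * v ^ (1 - q) = v * a ^ q := by
    intro a v h0 ht
    rw [ENNReal.mul_rpow_of_nonneg _ _ hq0.le, mul_right_comm, ← ENNReal.rpow_add _ _ h0 ht,
      add_sub_cancel, ENNReal.rpow_one]
  have hM : ∀ x, dyadicMax ν f x ≤
      K * u x * dyadicMax (ν.withDensity u) (fun x => f x / u x) x := by
    intro x
    refine iSup_le fun k => ?_
    have h0 := (measure_closedBall_pos ν x (show (0 : ℝ) < 2 ^ k by positivity)).ne'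
    have ht := (measure_closedBall_lt_top (μ := ν) (x := x) (r := 2 ^ k)).ne
    have h1 : ∫⁻ y in closedBall x (2 ^ k), f y ∂ν =
        ∫⁻ y in closedBall x (2 ^ k), f y / u y ∂(ν.withDensity u) := by
      rw [setLIntegral_withDensity_eq_setLIntegral_mul _ hu hg measurableSet_closedBall]
      refine lintegral_congr_ae ((ae_restrict_of_ae hutop).mono fun y hy => ?_)
      exact (ENNReal.mul_div_cancel (hu0 y) hy).symm
    have h2 : (ν.withDensity u) (closedBall x (2 ^ k)) ≤ K * u x * ν (closedBall x (2 ^ k)) := by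
      rw [withDensity_apply _ measurableSet_closedBall]
      exact (lintegral_closedBall_le_dyadicMax dyadicDoubling_addHaar u x k).trans
        (mul_le_mul_left (hA x) _)
    rw [← ENNReal.div_eq_inv_mul, ENNReal.div_le_iff_le_mul (Or.inl h0) (Or.inl ht), h1]
    calc _ ≤ dyadicMax (ν.withDensity u) (fun x => f x / u x) x *
          (ν.withDensity u) (closedBall x (2 ^ k)) :=
          lintegral_closedBall_le_dyadicMax hD _ x k
      _ ≤ dyadicMax (ν.withDensity u) (fun x => f x / u x) x *
          (K * u x * ν (closedBall x (2 ^ k))) := mul_le_mul_right h2 _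
      _ = _ := by ring
  have hMm : Measurable (dyadicMax (ν.withDensity u) fun x => f x / u x) := measurable_dyadicMax hg
  calc ∫⁻ x, dyadicMax ν f x ^ q * u x ^ (1 - q) ∂ν
      ≤ ∫⁻ x, K ^ q * (u x * dyadicMax (ν.withDensity u) (fun x => f x / u x) x ^ q) ∂ν := by
        refine lintegral_mono_ae (hutop.mono fun x hx => ?_)
        rw [← hpow _ _ (hu0 x) hx, ← mul_assoc, ← ENNReal.mul_rpow_of_nonneg _ _ hq0.le,
          ← mul_assoc]
        exact mul_le_mul_left (ENNReal.rpow_le_rpow (hM x) hq0.le) _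
    _ = K ^ q * ∫⁻ x, dyadicMax (ν.withDensity u) (fun x => f x / u x) x ^ q
          ∂(ν.withDensity u) := by
        rw [lintegral_withDensity_eq_lintegral_mul _ hu (hMm.pow_const q)]
        exact lintegral_const_mul _ (hu.mul (hMm.pow_const q))
    _ ≤ K ^ q * (dyadicMaxConst D q * ∫⁻ x, (f x / u x) ^ q ∂(ν.withDensity u)) :=
        mul_le_mul_right (lintegral_dyadicMax_rpow_le hD hg hq) _
    _ = K ^ q * dyadicMaxConst D q * ∫⁻ x, f x ^ q * u x ^ (1 - q) ∂ν := by
        rw [mul_assoc, lintegral_withDensity_eq_lintegral_mul _ hu (hg.pow_const q)]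
        congr 2
        refine lintegral_congr_ae (hutop.mono fun x hx => ?_)
        simp only [Pi.mul_apply]
        rw [← hpow _ _ (hu0 x) hx, ENNReal.mul_div_cancel (hu0 x) hx]

lemma dyadicMax_rpow_le (R : E → ℝ≥0∞) (hR : Measurable R) {θ : ℝ} (h0 : 0 ≤ θ) (h1 : θ ≤ 1)
    (x : E) : dyadicMax ν (fun y => R y ^ θ) x ≤ dyadicMax ν R x ^ θ := by
  refine iSup_le fun k => ?_
  have hV0 := (measure_closedBall_pos ν x (show (0 : ℝ) < 2 ^ k by positivity)).ne'
  have hVt := (measure_closedBall_lt_top (μ := ν) (x := x) (r := 2 ^ k)).ne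
  rw [← ENNReal.div_eq_inv_mul, ENNReal.div_le_iff_le_mul (Or.inl hV0) (Or.inl hVt)]
  have hH := ENNReal.lintegral_mul_norm_pow_le (μ := ν.restrict (closedBall x (2 ^ k)))
    hR.aemeasurable (aemeasurable_const (b := (1 : ℝ≥0∞))) h0 (sub_nonneg.2 h1)
    (add_sub_cancel θ 1)
  simp only [ENNReal.one_rpow, mul_one, setLIntegral_one] at hH
  set V := ν (closedBall x (2 ^ k))
  calc ∫⁻ y in closedBall x (2 ^ k), R y ^ θ ∂ν
      ≤ (∫⁻ y in closedBall x (2 ^ k), R y ∂ν) ^ θ * V ^ (1 - θ) := hH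
    _ ≤ (dyadicMax ν R x * V) ^ θ * V ^ (1 - θ) := by
        gcongr
        exact lintegral_closedBall_le_dyadicMax dyadicDoubling_addHaar R x k
    _ = dyadicMax ν R x ^ θ * V := by
        rw [ENNReal.mul_rpow_of_nonneg _ _ h0, mul_assoc, ← ENNReal.rpow_add _ _ hV0 hVt,
          add_sub_cancel, ENNReal.rpow_one]

lemma tsum_inv_two_pow : ∑' n : ℕ, (2⁻¹ : ℝ≥0∞) ^ n = 2 := by
  rw [ENNReal.tsum_geometric, ENNReal.one_sub_inv_two, inv_inv]

/-- The Rubio de Francia algorithm: every `L^p` function has an `L^p` majorant that is an `A₁`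
weight, with uniform constants. -/
lemma exists_dyadicMax_le_mul (ν : Measure E) [ν.IsAddHaarMeasure] {p : ℝ} (hp : 1 < p) :
    ∃ K : ℝ≥0∞, K ≠ ∞ ∧ ∃ C : ℝ≥0∞, C ≠ ∞ ∧ ∀ F : E → ℝ≥0∞, Measurable F →
      ∃ R : E → ℝ≥0∞, Measurable R ∧ (∀ x, F x ≤ R x) ∧
        (∀ x, dyadicMax ν R x ≤ K * R x) ∧
        ∫⁻ x, R x ^ p ∂ν ≤ C * ∫⁻ x, F x ^ p ∂ν := by
  have hp0 : 0 < p := by linarith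
  set A := dyadicMaxConst (ENNReal.ofReal (5 ^ Module.finrank ℝ E)) p
  have hA : A ≠ ∞ := dyadicMaxConst_ne_top ENNReal.ofReal_ne_top hp
  set b := A + 1
  have hb : b ≠ ∞ := by finiteness
  have hb0 : b ≠ 0 := by simp [b]
  have hAb : A ≤ b ^ p := calc
    A ≤ b := le_self_add
    _ = b ^ (1 : ℝ) := (ENNReal.rpow_one b).symm
    _ ≤ b ^ p := ENNReal.rpow_le_rpow_of_exponent_le le_add_self hp.le
  have hbp0 : b ^ p ≠ 0 := by simp [hb0, hb]
  have hbpt : b ^ p ≠ ∞ := ENNReal.rpow_ne_top_of_nonneg hp0.le hb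
  have hK0 : 4 * b ≠ 0 := by simp [hb0]
  have hKt : 4 * b ≠ ∞ := by finiteness
  refine ⟨4 * b, hKt, 2 ^ p * 2, ENNReal.mul_ne_top
    (ENNReal.rpow_ne_top_of_nonneg hp0.le (by simp)) (by simp), fun F hF => ?_⟩
  let m : ℕ → E → ℝ≥0∞ := fun n => (dyadicMax ν)^[n] F
  have hm_succ : ∀ n, m (n + 1) = dyadicMax ν (m n) := fun n => Function.iterate_succ_apply' _ _ _
  have hm : ∀ n, Measurable (m n) := by
    intro n
    induction n with
    | zero => exact hF
    | succ n ih => rw [hm_succ]; exact measurable_dyadicMax ih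
  have hmp : ∀ n, ∫⁻ x, m n x ^ p ∂ν ≤ (b ^ p) ^ n * ∫⁻ x, F x ^ p ∂ν := by
    intro n
    induction n with
    | zero => simp [m]
    | succ n ih =>
      rw [hm_succ, pow_succ', mul_assoc]
      exact (lintegral_dyadicMax_rpow_le dyadicDoubling_addHaar (hm n) hp).trans
        (mul_le_mul' hAb ih)
  refine ⟨fun x => ∑' n, ((4 * b)⁻¹) ^ n * m n x,
    Measurable.tsum fun n => (hm n).const_mul _, fun x => ?_, fun x => ?_, ?_⟩
  · refine le_trans ?_ (ENNReal.le_tsum 0)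
    simp [m]
  · refine (dyadicMax_tsum_le m hm _ x).trans ?_
    calc ∑' n, ((4 * b)⁻¹) ^ n * dyadicMax ν (m n) x
        = 4 * b * ∑' n, ((4 * b)⁻¹) ^ (n + 1) * m (n + 1) x := by
          rw [← ENNReal.tsum_mul_left]
          congr 1 with n
          rw [hm_succ, pow_succ', ← mul_assoc, ← mul_assoc, ENNReal.mul_inv_cancel hK0 hKt,
            one_mul]
      _ ≤ 4 * b * ∑' n, ((4 * b)⁻¹) ^ n * m n x := by
          exact mul_le_mul_right (ENNReal.tsum_comp_le_tsum_of_injective (add_left_injective 1)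
            (fun n => ((4 * b)⁻¹) ^ n * m n x)) _
  · have hsplit : ∀ n, ((4 * b)⁻¹) ^ n = (2⁻¹ : ℝ≥0∞) ^ n * ((2 * b)⁻¹) ^ n := by
      intro n
      rw [← mul_pow, ← ENNReal.mul_inv (by simp) (by simp), ← mul_assoc]
      norm_num
    have hpt : ∀ x, (∑' n, ((4 * b)⁻¹) ^ n * m n x) ^ p ≤
        2 ^ p * ∑' n, ((2 * b)⁻¹ ^ n) ^ p * m n x ^ p := by
      intro x
      have hsum : ∑' n, ((4 * b)⁻¹) ^ n * m n x ≤ 2 * ⨆ n, (2 * b)⁻¹ ^ n * m n x := by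
        refine le_of_le_of_eq ?_ (congrArg (· * ⨆ n, (2 * b)⁻¹ ^ n * m n x) tsum_inv_two_pow)
        simp only [← ENNReal.tsum_mul_right]
        refine ENNReal.tsum_le_tsum fun n => ?_
        rw [hsplit, mul_assoc]
        exact mul_le_mul_right (le_iSup (fun n => (2 * b)⁻¹ ^ n * m n x) n) _
      have hsup : (⨆ n, (2 * b)⁻¹ ^ n * m n x) ≤
          (∑' n, ((2 * b)⁻¹ ^ n) ^ p * m n x ^ p) ^ p⁻¹ := by
        refine iSup_le fun n => ?_
        rw [ENNReal.le_rpow_inv_iff hp0, ENNReal.mul_rpow_of_nonneg _ _ hp0.le]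
        exact ENNReal.le_tsum n
      calc _ ≤ (2 * ⨆ n, (2 * b)⁻¹ ^ n * m n x) ^ p := ENNReal.rpow_le_rpow hsum hp0.le
        _ = 2 ^ p * (⨆ n, (2 * b)⁻¹ ^ n * m n x) ^ p := ENNReal.mul_rpow_of_nonneg _ _ hp0.le
        _ ≤ _ := mul_le_mul_right ((ENNReal.le_rpow_inv_iff hp0).1 hsup) _
    have hcoef : ∀ n, ((2 * b)⁻¹ ^ n) ^ p * (b ^ p) ^ n ≤ (2⁻¹ : ℝ≥0∞) ^ n := by
      intro n
      have e1 : ((2 * b)⁻¹ ^ n) ^ p = ((2 * b)⁻¹ ^ p) ^ n := by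
        rw [← ENNReal.rpow_natCast, ← ENNReal.rpow_natCast, ← ENNReal.rpow_mul,
          ← ENNReal.rpow_mul, mul_comm (n : ℝ)]
      rw [e1, ← mul_pow, ← ENNReal.mul_rpow_of_nonneg _ _ hp0.le,
        ENNReal.mul_inv (by simp) (by simp), mul_assoc, ENNReal.inv_mul_cancel hb0 hb, mul_one]
      gcongr
      calc (2⁻¹ : ℝ≥0∞) ^ p ≤ (2⁻¹ : ℝ≥0∞) ^ (1 : ℝ) :=
            ENNReal.rpow_le_rpow_of_exponent_ge (by simp) hp.le
        _ = 2⁻¹ := ENNReal.rpow_one _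
    calc ∫⁻ x, (∑' n, ((4 * b)⁻¹) ^ n * m n x) ^ p ∂ν
        ≤ ∫⁻ x, 2 ^ p * ∑' n, ((2 * b)⁻¹ ^ n) ^ p * m n x ^ p ∂ν := lintegral_mono hpt
      _ = 2 ^ p * ∑' n, ((2 * b)⁻¹ ^ n) ^ p * ∫⁻ x, m n x ^ p ∂ν := by
          have h1 : ∀ n, Measurable fun x => ((2 * b)⁻¹ ^ n) ^ p * m n x ^ p :=
            fun n => ((hm n).pow_const p).const_mul _
          rw [lintegral_const_mul _ (Measurable.tsum h1),
            lintegral_tsum fun n => (h1 n).aemeasurable]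
          congr 2 with n
          rw [lintegral_const_mul _ ((hm n).pow_const p)]
      _ ≤ 2 ^ p * ∑' n : ℕ, (2⁻¹ : ℝ≥0∞) ^ n * ∫⁻ x, F x ^ p ∂ν := by
          refine mul_le_mul_right (ENNReal.tsum_le_tsum fun n => ?_) _
          calc _ ≤ ((2 * b)⁻¹ ^ n) ^ p * ((b ^ p) ^ n * ∫⁻ x, F x ^ p ∂ν) :=
                mul_le_mul_right (hmp n) _
            _ ≤ _ := by
                rw [← mul_assoc]
                exact mul_le_mul_left (hcoef n) _
      _ = 2 ^ p * 2 * ∫⁻ x, F x ^ p ∂ν := by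
          rw [ENNReal.tsum_mul_right, tsum_inv_two_pow, mul_assoc]

end HaarMaximal

section Heat

lemma exp_neg_le_factorial_mul (N : ℕ) {s : ℝ} (hs : 0 < s) :
    Real.exp (-s) ≤ N.factorial * (s ^ N)⁻¹ := by
  have h := Real.pow_div_factorial_le_exp s hs.le N
  rw [Real.exp_neg]
  calc (Real.exp s)⁻¹ ≤ (s ^ N / N.factorial)⁻¹ := inv_anti₀ (by positivity) h
    _ = N.factorial * (s ^ N)⁻¹ := by rw [inv_div, div_eq_mul_inv]

/-- The heat kernel is bounded by a rapidly decreasing coefficient on some dyadic multiple of the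
ball of radius comparable to `√t`. -/
lemma exists_heatKernel_le (d : ℕ) {t a ρ : ℝ} (ha : 0 < a) (hat : a ≤ √t) (hta : √t < 2 * a) :
    ∃ j : ℕ, ρ ≤ a * 2 ^ j ∧
      (4 * Real.pi * t) ^ (-(d : ℝ) / 2) * Real.exp (-ρ ^ 2 / (4 * t)) ≤
        (a ^ d)⁻¹ * ((d + 1).factorial * 64 ^ (d + 1) * ((4 ^ (d + 1)) ^ j)⁻¹) := by
  classical
  have hst : 0 < √t := ha.trans_le hat
  have ht : 0 < t := Real.sqrt_pos.1 hst
  have hsq : √t ^ 2 = t := Real.sq_sqrt ht.le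
  have hex : ∃ j : ℕ, ρ ≤ a * 2 ^ j := by
    obtain ⟨j, hj⟩ := pow_unbounded_of_one_lt (ρ / a) one_lt_two
    exact ⟨j, by rw [mul_comm]; exact ((div_lt_iff₀ ha).1 hj).le⟩
  refine ⟨Nat.find hex, Nat.find_spec hex, ?_⟩
  have hfac : (1 : ℝ) ≤ (d + 1).factorial := by
    exact_mod_cast Nat.succ_le_of_lt (Nat.factorial_pos (d + 1))
  refine mul_le_mul ?_ ?_ (Real.exp_pos _).le (by positivity)
  · calc (4 * Real.pi * t) ^ (-(d : ℝ) / 2) ≤ t ^ (-(d : ℝ) / 2) := by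
          refine Real.rpow_le_rpow_of_nonpos ht ?_ ?_
          · nlinarith [Real.pi_gt_three]
          · have : (0 : ℝ) ≤ d := by positivity
            linarith
      _ = (√t ^ d)⁻¹ := by
          rw [Real.sqrt_eq_rpow, ← Real.rpow_natCast, ← Real.rpow_mul ht.le, ← Real.rpow_neg ht.le]
          congr 1
          ring
      _ ≤ (a ^ d)⁻¹ := by gcongr
  · cases hj : Nat.find hex with
    | zero =>
      calc Real.exp (-ρ ^ 2 / (4 * t)) ≤ 1 := by
            rw [Real.exp_le_one_iff]
            exact div_nonpos_of_nonpos_of_nonneg (by nlinarith) (by positivity)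
        _ ≤ _ := by
            rw [pow_zero, inv_one, mul_one]
            exact one_le_mul_of_one_le_of_one_le hfac (one_le_pow₀ (by norm_num))
    | succ i =>
      have hi : a * 2 ^ i < ρ := not_le.1 (Nat.find_min hex (by omega))
      have hs : (4 : ℝ) ^ (i + 1) / 64 ≤ ρ ^ 2 / (4 * t) := by
        have h1 : (a * 2 ^ i) ^ 2 ≤ ρ ^ 2 := by gcongr
        have h2 : t ≤ (2 * a) ^ 2 := by
          rw [← hsq]
          gcongr
        have h4 : (4 : ℝ) ^ i = (2 ^ i) ^ 2 := by
          rw [← pow_mul, mul_comm, pow_mul]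
          norm_num
        rw [div_le_div_iff₀ (by norm_num) (by positivity), pow_succ, h4]
        nlinarith [sq_nonneg ((2 : ℝ) ^ i)]
      calc Real.exp (-ρ ^ 2 / (4 * t)) ≤ Real.exp (-((4 : ℝ) ^ (i + 1) / 64)) := by
            rw [Real.exp_le_exp, neg_div]
            linarith
        _ ≤ (d + 1).factorial * (((4 : ℝ) ^ (i + 1) / 64) ^ (d + 1))⁻¹ :=
            exp_neg_le_factorial_mul _ (by positivity)
        _ = _ := by
            rw [div_pow, inv_div, div_eq_mul_inv, mul_assoc, ← pow_mul, ← pow_mul,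
              mul_comm (i + 1)]

variable {d : ℕ}

/-- The heat semigroup is controlled pointwise by the maximal function, uniformly in time. -/
lemma exists_heatAbs_le (d : ℕ) : ∃ C : ℝ≥0∞, C ≠ ∞ ∧
    ∀ f : EuclideanSpace ℝ (Fin d) → ℝ, Measurable f → ∀ t : ℝ, 0 < t → ∀ x,
      heatAbs f t x ≤ C * dyadicMax volume (fun y => (‖f y‖₊ : ℝ≥0∞)) x := by
  set V := volume (closedBall (0 : EuclideanSpace ℝ (Fin d)) 1)
  have hV : V ≠ ∞ := measure_closedBall_lt_top.ne
  set A : ℝ := (d + 1).factorial * 64 ^ (d + 1)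
  have hA : 0 ≤ A := by positivity
  refine ⟨ENNReal.ofReal A * V * 2, by finiteness, fun f hf t ht x => ?_⟩
  obtain ⟨k, hk1, hk2⟩ := _root_.exists_mem_Ico_zpow (Real.sqrt_pos.2 ht) (one_lt_two (α := ℝ))
  rw [zpow_add₀ two_ne_zero, zpow_one, mul_comm] at hk2
  have hk0 : (0 : ℝ) < 2 ^ k := by positivity
  set w : EuclideanSpace ℝ (Fin d) → ℝ≥0∞ := fun y => (‖f y‖₊ : ℝ≥0∞) with hw
  have hwm : Measurable w := hf.nnnorm.coe_nnreal_ennreal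
  set c : ℕ → ℝ := fun j => (((2 : ℝ) ^ k) ^ d)⁻¹ * (A * ((4 ^ (d + 1)) ^ j)⁻¹) with hc
  have hrad : ∀ j : ℕ, (2 : ℝ) ^ k * 2 ^ j = 2 ^ (k + j) := fun j => by
    rw [zpow_add₀ two_ne_zero, zpow_natCast]
  have hpt : ∀ y, ENNReal.ofReal ((4 * Real.pi * t) ^ (-(d : ℝ) / 2) *
      Real.exp (-‖x - y‖ ^ 2 / (4 * t))) * w y ≤
      ∑' j : ℕ, ENNReal.ofReal (c j) * (closedBall x (2 ^ (k + j))).indicator w y := by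
    intro y
    obtain ⟨j, hj, hle⟩ := exists_heatKernel_le d (ρ := ‖x - y‖) hk0 hk1 hk2
    have hy : y ∈ closedBall x (2 ^ (k + j)) := by
      rw [mem_closedBall', dist_eq_norm, ← hrad]
      exact hj
    refine le_trans ?_ (ENNReal.le_tsum j)
    rw [indicator_of_mem hy]
    exact mul_le_mul_left (ENNReal.ofReal_le_ofReal hle) _
  have hcoef : ∀ j : ℕ, ENNReal.ofReal (c j) * volume (closedBall x (2 ^ (k + j))) ≤
      ENNReal.ofReal A * V * 2⁻¹ ^ j := by
    intro j
    have h1 := addHaar_closedBall_mul_radius (ν := volume) x (0 : EuclideanSpace ℝ (Fin d))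
      (c := 2 ^ (k + j)) (r := 1) (by positivity) zero_le_one
    rw [mul_one, finrank_euclideanSpace_fin] at h1
    have h2 : c j * ((2 : ℝ) ^ (k + j)) ^ d ≤ A * 2⁻¹ ^ j := by
      rw [← hrad, mul_pow, hc]
      have e : (((2 : ℝ) ^ k) ^ d)⁻¹ * (A * ((4 ^ (d + 1)) ^ j)⁻¹) * (((2 : ℝ) ^ k) ^ d *
          (2 ^ j) ^ d) = A * ((2 ^ d * (4 ^ (d + 1))⁻¹) ^ j) := by
        have hX : ((2 : ℝ) ^ k) ^ d ≠ 0 := by positivity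
        rw [mul_pow, inv_pow, ← pow_mul 2 j d, mul_comm j d, pow_mul 2 d j]
        generalize ((2 : ℝ) ^ k) ^ d = X at hX
        generalize (((4 : ℝ) ^ (d + 1)) ^ j)⁻¹ = Y
        field_simp
      rw [e]
      have e' : (2 : ℝ) ^ d * (4 ^ (d + 1))⁻¹ ≤ 2⁻¹ := by
        have : (2 : ℝ) ^ d * (4 ^ d)⁻¹ ≤ 1 := by
          rw [← div_eq_mul_inv, ← div_pow]
          exact pow_le_one₀ (by norm_num) (by norm_num)
        rw [pow_succ, mul_inv]
        linarith
      exact mul_le_mul_of_nonneg_left (pow_le_pow_left₀ (by positivity) e' j) hA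
    have h3 : (2⁻¹ : ℝ≥0∞) ^ j = ENNReal.ofReal (2⁻¹ ^ j) := by
      rw [ENNReal.ofReal_pow (by norm_num), ENNReal.ofReal_inv_of_pos two_pos]
      simp
    rw [h1, ← mul_assoc, ← ENNReal.ofReal_mul (by positivity), mul_right_comm (ENNReal.ofReal A), h3,
      ← ENNReal.ofReal_mul hA]
    exact mul_le_mul_left (ENNReal.ofReal_le_ofReal h2) _
  calc heatAbs f t x
      ≤ ∫⁻ y, ∑' j : ℕ, ENNReal.ofReal (c j) * (closedBall x (2 ^ (k + j))).indicator w y :=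
        lintegral_mono hpt
    _ = ∑' j : ℕ, ENNReal.ofReal (c j) * ∫⁻ y in closedBall x (2 ^ (k + j)), w y := by
        rw [lintegral_tsum fun j =>
          ((hwm.indicator measurableSet_closedBall).const_mul _).aemeasurable]
        congr 1 with j
        rw [lintegral_const_mul _ (hwm.indicator measurableSet_closedBall),
          lintegral_indicator measurableSet_closedBall]
    _ ≤ ∑' j : ℕ, ENNReal.ofReal A * V * 2⁻¹ ^ j * dyadicMax volume w x := by
        refine ENNReal.tsum_le_tsum fun j => ?_
        calc _ ≤ ENNReal.ofReal (c j) * (dyadicMax volume w x *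
              volume (closedBall x (2 ^ (k + j)))) := mul_le_mul_right
                (lintegral_closedBall_le_dyadicMax dyadicDoubling_addHaar w x _) _
          _ = ENNReal.ofReal (c j) * volume (closedBall x (2 ^ (k + j))) *
              dyadicMax volume w x := by ring
          _ ≤ _ := mul_le_mul_left (hcoef j) _
    _ = ENNReal.ofReal A * V * 2 * dyadicMax volume w x := by
        rw [ENNReal.tsum_mul_right, ENNReal.tsum_mul_left, tsum_inv_two_pow]

lemma heatMax_le_of_heatAbs_le {f : EuclideanSpace ℝ (Fin d) → ℝ} {x : EuclideanSpace ℝ (Fin d)}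
    {B : ℝ≥0∞} (h : ∀ t : ℝ, 0 < t → heatAbs f t x ≤ B) : heatMax f x ≤ B := by
  refine iSup₂_le fun α hα => ?_
  have h0 : ENNReal.ofReal α ≠ 0 := by simpa using hα
  calc (ENNReal.ofReal α)⁻¹ * ∫⁻ t in Set.Ioc (0 : ℝ) α, heatAbs f t x
      ≤ (ENNReal.ofReal α)⁻¹ * ∫⁻ _ in Set.Ioc (0 : ℝ) α, B := by
        gcongr 1
        exact setLIntegral_mono' measurableSet_Ioc fun t ht => h t ht.1
    _ = B := by
        rw [setLIntegral_const, Real.volume_Ioc, sub_zero, mul_comm B, ← mul_assoc,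
          ENNReal.inv_mul_cancel h0 ENNReal.ofReal_ne_top, one_mul]

end Heat

section VectorValued

variable {E : Type*} [NormedAddCommGroup E] [NormedSpace ℝ E] [FiniteDimensional ℝ E]
  [MeasurableSpace E] [BorelSpace E]

/-- The Fefferman–Stein vector-valued maximal inequality for `1 < p ≤ q < ∞`, for the maximal
function over balls of dyadic radius. -/
theorem exists_lintegral_tsum_dyadicMax_le (ν : Measure E) [ν.IsAddHaarMeasure] {p q : ℝ}
    (hp : 1 < p) (hpq : p ≤ q) :
    ∃ C : ℝ≥0∞, C ≠ ∞ ∧ ∀ f : ℕ → E → ℝ≥0∞, (∀ n, Measurable (f n)) →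
      ∫⁻ x, (∑' n, f n x ^ q) ^ (p / q) ∂ν ≠ ∞ →
      ∫⁻ x, (∑' n, dyadicMax ν (f n) x ^ q) ^ (p / q) ∂ν ≤
        C * ∫⁻ x, (∑' n, f n x ^ q) ^ (p / q) ∂ν := by
  have hp0 : 0 < p := by linarith
  have hq : 1 < q := by linarith
  have hq0 : 0 < q := by linarith
  have hpq0 : 0 < p / q := by positivity
  have hpq1 : p / q ≤ 1 := (div_le_one hq0).2 hpq
  obtain ⟨K, hK, C, hC, hR⟩ := exists_dyadicMax_le_mul ν hp
  set θ : ℝ := (q - p) / (q - 1) with hθ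
  have hθ0 : 0 ≤ θ := div_nonneg (by linarith) (by linarith)
  have hθ1 : θ ≤ 1 := (div_le_one (by linarith)).2 (by linarith)
  have hθq : θ * (1 - q) = p - q := by
    rw [hθ, div_mul_eq_mul_div, div_eq_iff (by linarith)]
    ring
  have hKθ : K ^ θ ≠ ∞ := ENNReal.rpow_ne_top_of_nonneg hθ0 hK
  set B := (K ^ θ) ^ q * dyadicMaxConst (K ^ θ * ENNReal.ofReal (8 ^ Module.finrank ℝ E)) q
  have hB : B ≠ ∞ := ENNReal.mul_ne_top (ENNReal.rpow_ne_top_of_nonneg hq0.le hKθ)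
    (dyadicMaxConst_ne_top (by finiteness) hq)
  refine ⟨B ^ (p / q) * C ^ (1 - p / q), ENNReal.mul_ne_top
    (ENNReal.rpow_ne_top_of_nonneg hpq0.le hB)
    (ENNReal.rpow_ne_top_of_nonneg (by linarith) hC), fun f hf hfin => ?_⟩
  set S : E → ℝ≥0∞ := fun x => ∑' n, f n x ^ q with hS
  set T : E → ℝ≥0∞ := fun x => ∑' n, dyadicMax ν (f n) x ^ q with hT
  have hSm : Measurable S := Measurable.tsum fun n => (hf n).pow_const q
  have hTm : Measurable T := Measurable.tsum fun n => (measurable_dyadicMax (hf n)).pow_const q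
  by_cases hzero : ∫⁻ x, S x ^ (p / q) ∂ν = 0
  · have hS0 : S =ᵐ[ν] 0 := by
      filter_upwards [(lintegral_eq_zero_iff (hSm.pow_const _)).1 hzero] with x hx
      simpa [ENNReal.rpow_eq_zero_iff, hpq0, hpq0.not_gt] using hx
    have hf0 : ∀ n, f n =ᵐ[ν] 0 := by
      intro n
      filter_upwards [hS0] with x hx
      have := (ENNReal.tsum_eq_zero.1 hx) n
      simpa [ENNReal.rpow_eq_zero_iff, hq0, hq0.not_gt] using this
    have hM0 : ∀ n x, dyadicMax ν (f n) x = 0 := by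
      intro n x
      refine le_antisymm (iSup_le fun k => ?_) zero_le
      rw [lintegral_congr_ae (ae_restrict_of_ae (hf0 n))]
      simp
    simp [hM0, hq0, hpq0]
  obtain ⟨R, hRm, hFR, hRA, hRp⟩ := hR (fun x => S x ^ q⁻¹) (hSm.pow_const _)
  have hSp : ∀ x, (S x ^ q⁻¹) ^ p = S x ^ (p / q) := fun x => by
    rw [← ENNReal.rpow_mul, inv_mul_eq_div]
  simp_rw [hSp] at hRp
  have hRpt : ∫⁻ x, R x ^ p ∂ν ≠ ∞ := ne_top_of_le_ne_top (ENNReal.mul_ne_top hC hfin) hRp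
  have hRtop : ∀ᵐ x ∂ν, R x ≠ ∞ := by
    filter_upwards [ae_lt_top (hRm.pow_const p) hRpt] with x hx h
    simp [h, hp0] at hx
  have hR0 : ∀ x, R x ≠ 0 := by
    intro x hx
    have h1 : dyadicMax ν R x = 0 := by simpa [hx] using hRA x
    have h2 : ∀ k : ℕ, ∀ᵐ y ∂ν, y ∈ closedBall x (2 ^ (k : ℤ)) → R y = 0 := by
      intro k
      have h3 := lintegral_closedBall_le_dyadicMax (dyadicDoubling_addHaar (ν := ν)) R x k
      rw [h1, zero_mul, nonpos_iff_eq_zero,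
        setLIntegral_eq_zero_iff measurableSet_closedBall hRm] at h3
      exact h3
    have h4 : R =ᵐ[ν] 0 := by
      filter_upwards [ae_all_iff.2 h2] with y hy
      obtain ⟨k, hk⟩ := pow_unbounded_of_one_lt (dist y x) one_lt_two
      exact hy k (by rw [mem_closedBall, zpow_natCast]; exact hk.le)
    refine hzero ((lintegral_congr_ae ?_).trans lintegral_zero)
    filter_upwards [h4] with y hy
    have h5 : S y ^ q⁻¹ = 0 := le_antisymm ((hFR y).trans hy.le) zero_le
    rw [← hSp, h5, ENNReal.zero_rpow_of_pos hp0]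
  have hum : Measurable fun x => R x ^ θ := hRm.pow_const θ
  have hu0 : ∀ᵐ x ∂ν, R x ^ θ ≠ ∞ :=
    hRtop.mono fun x hx => ENNReal.rpow_ne_top_of_nonneg hθ0 hx
  have huA : ∀ x, dyadicMax ν (fun y => R y ^ θ) x ≤ K ^ θ * R x ^ θ := fun x =>
    (dyadicMax_rpow_le R hRm hθ0 hθ1 x).trans <| by
      rw [← ENNReal.mul_rpow_of_nonneg _ _ hθ0]
      exact ENNReal.rpow_le_rpow (hRA x) hθ0
  have hweight : ∀ x, (R x ^ θ) ^ (1 - q) = R x ^ (p - q) := fun x => by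
    rw [← ENNReal.rpow_mul, hθq]
  have hscalar : ∀ n, ∫⁻ x, dyadicMax ν (f n) x ^ q * R x ^ (p - q) ∂ν ≤
      B * ∫⁻ x, f n x ^ q * R x ^ (p - q) ∂ν := by
    intro n
    have := lintegral_dyadicMax_rpow_mul_le (ν := ν) hum
      (fun x => by simp [ENNReal.rpow_eq_zero_iff, hR0 x, hθ0.not_gt]) hu0 hKθ huA (hf n) hq
    simpa only [hweight] using this
  have hvec : ∫⁻ x, T x * R x ^ (p - q) ∂ν ≤ B * ∫⁻ x, S x * R x ^ (p - q) ∂ν := by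
    have h1 : ∀ n, Measurable fun x => dyadicMax ν (f n) x ^ q * R x ^ (p - q) := fun n =>
      ((measurable_dyadicMax (hf n)).pow_const q).mul (hRm.pow_const _)
    have h2 : ∀ n, Measurable fun x => f n x ^ q * R x ^ (p - q) := fun n =>
      ((hf n).pow_const q).mul (hRm.pow_const _)
    simp only [hS, hT, ← ENNReal.tsum_mul_right]
    rw [lintegral_tsum fun n => (h1 n).aemeasurable, lintegral_tsum fun n => (h2 n).aemeasurable,
      ← ENNReal.tsum_mul_left]
    exact ENNReal.tsum_le_tsum hscalar
  have hSR : ∫⁻ x, S x * R x ^ (p - q) ∂ν ≤ ∫⁻ x, S x ^ (p / q) ∂ν := by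
    refine lintegral_mono_ae (hRtop.mono fun x hx => ?_)
    have e1 : S x = (S x ^ q⁻¹) ^ p * (S x ^ q⁻¹) ^ (q - p) := by
      rw [← ENNReal.rpow_add_of_nonneg _ _ hp0.le (by linarith), add_sub_cancel,
        ENNReal.rpow_inv_rpow hq0.ne']
    calc S x * R x ^ (p - q) = S x ^ (p / q) * ((S x ^ q⁻¹) ^ (q - p) * R x ^ (p - q)) := by
          conv_lhs => rw [e1]
          rw [hSp, mul_assoc]
      _ ≤ S x ^ (p / q) * (R x ^ (q - p) * R x ^ (p - q)) := by
          exact mul_le_mul_right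
            (mul_le_mul_left (ENNReal.rpow_le_rpow (hFR x) (by linarith)) _) _
      _ = S x ^ (p / q) := by
          rw [← ENNReal.rpow_add _ _ (hR0 x) hx, sub_add_sub_cancel, sub_self, ENNReal.rpow_zero,
            mul_one]
  calc ∫⁻ x, T x ^ (p / q) ∂ν
      = ∫⁻ x, (T x * R x ^ (p - q)) ^ (p / q) * (R x ^ p) ^ (1 - p / q) ∂ν := by
        refine lintegral_congr_ae (hRtop.mono fun x hx => ?_)
        simp only
        rw [ENNReal.mul_rpow_of_nonneg _ _ hpq0.le, mul_assoc, ← ENNReal.rpow_mul,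
          ← ENNReal.rpow_mul, ← ENNReal.rpow_add _ _ (hR0 x) hx]
        have : (p - q) * (p / q) + p * (1 - p / q) = 0 := by
          field_simp
          ring
        rw [this, ENNReal.rpow_zero, mul_one]
    _ ≤ (∫⁻ x, T x * R x ^ (p - q) ∂ν) ^ (p / q) * (∫⁻ x, R x ^ p ∂ν) ^ (1 - p / q) :=
        ENNReal.lintegral_mul_norm_pow_le (hTm.mul (hRm.pow_const _)).aemeasurable
          (hRm.pow_const _).aemeasurable hpq0.le (by linarith) (add_sub_cancel _ _)
    _ ≤ (B * ∫⁻ x, S x ^ (p / q) ∂ν) ^ (p / q) *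
          (C * ∫⁻ x, S x ^ (p / q) ∂ν) ^ (1 - p / q) := by
        refine mul_le_mul' (ENNReal.rpow_le_rpow ?_ hpq0.le) (ENNReal.rpow_le_rpow hRp
          (by linarith))
        exact hvec.trans (mul_le_mul_right hSR _)
    _ = B ^ (p / q) * C ^ (1 - p / q) * ∫⁻ x, S x ^ (p / q) ∂ν := by
        rw [ENNReal.mul_rpow_of_nonneg _ _ hpq0.le,
          ENNReal.mul_rpow_of_nonneg _ _ (show 0 ≤ 1 - p / q by linarith), mul_mul_mul_comm,
          ← ENNReal.rpow_add _ _ hzero hfin, add_sub_cancel, ENNReal.rpow_one]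

end VectorValued

/-- Fefferman-Stein type inequality for the Euclidean heat maximal operator,
`1 < p ≤ q < ∞`. -/
theorem fefferman_stein_heat_maximal {d : ℕ} (p q : ℝ) (hp : 1 < p) (hpq : p ≤ q) :
    ∃ C : ℝ, 0 < C ∧ ∀ f : ℕ → EuclideanSpace ℝ (Fin d) → ℝ,
      (∀ n, Measurable (f n)) →
      (∫⁻ x, (∑' n, (‖f n x‖₊ : ℝ≥0∞) ^ q) ^ (p / q) ∂volume) < ⊤ →
      (∫⁻ x, (∑' n, (heatMax (f n) x) ^ q) ^ (p / q) ∂volume) ^ (1 / p) ≤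
        ENNReal.ofReal C *
          (∫⁻ x, (∑' n, (‖f n x‖₊ : ℝ≥0∞) ^ q) ^ (p / q) ∂volume) ^ (1 / p) := by
  have hp0 : 0 < p := by linarith
  have hq0 : 0 < q := by linarith
  have hpq0 : 0 < p / q := by positivity
  obtain ⟨A, hA, hheat⟩ := exists_heatAbs_le d
  obtain ⟨B, hB, hvec⟩ :=
    exists_lintegral_tsum_dyadicMax_le (volume : Measure (EuclideanSpace ℝ (Fin d))) hp hpq
  have hD : (A ^ p * B) ^ (1 / p) ≠ ∞ := ENNReal.rpow_ne_top_of_nonneg (by positivity)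
    (ENNReal.mul_ne_top (ENNReal.rpow_ne_top_of_nonneg hp0.le hA) hB)
  refine ⟨((A ^ p * B) ^ (1 / p)).toReal + 1, by positivity, fun f hf hfin => ?_⟩
  have hmax : ∀ n x, heatMax (f n) x ≤
      A * dyadicMax volume (fun y => (‖f n y‖₊ : ℝ≥0∞)) x := fun n x =>
    heatMax_le_of_heatAbs_le fun t ht => hheat (f n) (hf n) t ht x
  have hpt : ∀ x, (∑' n, heatMax (f n) x ^ q) ^ (p / q) ≤
      A ^ p * (∑' n, dyadicMax volume (fun y => (‖f n y‖₊ : ℝ≥0∞)) x ^ q) ^ (p / q) := by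
    intro x
    calc (∑' n, heatMax (f n) x ^ q) ^ (p / q)
        ≤ (∑' n, A ^ q * dyadicMax volume (fun y => (‖f n y‖₊ : ℝ≥0∞)) x ^ q) ^ (p / q) := by
          refine ENNReal.rpow_le_rpow (ENNReal.tsum_le_tsum fun n => ?_) hpq0.le
          rw [← ENNReal.mul_rpow_of_nonneg _ _ hq0.le]
          exact ENNReal.rpow_le_rpow (hmax n x) hq0.le
      _ = _ := by
          rw [ENNReal.tsum_mul_left, ENNReal.mul_rpow_of_nonneg _ _ hpq0.le, ← ENNReal.rpow_mul,
            mul_div_cancel₀ _ hq0.ne']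
  have hint : ∫⁻ x, (∑' n, heatMax (f n) x ^ q) ^ (p / q) ≤
      A ^ p * B * ∫⁻ x, (∑' n, (‖f n x‖₊ : ℝ≥0∞) ^ q) ^ (p / q) := by
    refine (lintegral_mono hpt).trans ?_
    rw [lintegral_const_mul' _ _ (ENNReal.rpow_ne_top_of_nonneg hp0.le hA), mul_assoc]
    exact mul_le_mul_right
      (hvec (fun n y => (‖f n y‖₊ : ℝ≥0∞)) (fun n => (hf n).nnnorm.coe_nnreal_ennreal) hfin.ne) _
  calc _ ≤ (A ^ p * B * ∫⁻ x, (∑' n, (‖f n x‖₊ : ℝ≥0∞) ^ q) ^ (p / q)) ^ (1 / p) :=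
        ENNReal.rpow_le_rpow hint (by positivity)
    _ = (A ^ p * B) ^ (1 / p) * (∫⁻ x, (∑' n, (‖f n x‖₊ : ℝ≥0∞) ^ q) ^ (p / q)) ^ (1 / p) :=
        ENNReal.mul_rpow_of_nonneg _ _ (by positivity)
    _ ≤ _ := by
        refine mul_le_mul_left ?_ _
        refine (ENNReal.ofReal_toReal hD).ge.trans (ENNReal.ofReal_le_ofReal ?_)
        linarith
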